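/- arXiv:1011.3448 — 2 statements merged into one kernel-verified Lean document; each statement's English description precedes it below -/
import Mathlib

section
/- Over ℤ[1/2], the ring of PGL₂-invariants of ℤ[1/2][A₁,B₁,C₁,A₂,B₂,C₂] is the ℤ[1/2]-subalgebra generated by Δ₁, Δ₂, Γ, and moreover Δ₁, Δ₂, Γ are algebraically independent over ℤ[1/2], so the invariant ring is a polynomial ring ℤ[1/2][Δ₁,Δ₂,Γ]. -/
open MvPolynomial

noncomputable section

/-- The base ring `ℤ[1/2]`. -/
abbrev Zhalf : Type := Localization.Away (2 : ℤ)

/- Variables in `MvPolynomial (Fin 6) Zhalf`: `0 = A₁, 1 = B₁, 2 = C₁, 3 = A₂, 4 = B₂, 5 = C₂`.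
   Variables in `MvPolynomial (Fin 10) Zhalf`: `0 = a, 1 = b, 2 = c, 3 = d`, then `A₁,…,C₂`. -/

/-- The inclusion `ℤ[1/2][A₁,…,C₂] → ℤ[1/2][a,b,c,d][A₁,…,C₂]`. -/
def emb : MvPolynomial (Fin 6) Zhalf →ₐ[Zhalf] MvPolynomial (Fin 10) Zhalf :=
  aeval fun i => X ⟨i.val + 4, by omega⟩

def va : MvPolynomial (Fin 10) Zhalf := X 0
def vb : MvPolynomial (Fin 10) Zhalf := X 1
def vc : MvPolynomial (Fin 10) Zhalf := X 2
def vd : MvPolynomial (Fin 10) Zhalf := X 3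
def wA1 : MvPolynomial (Fin 10) Zhalf := X 4
def wB1 : MvPolynomial (Fin 10) Zhalf := X 5
def wC1 : MvPolynomial (Fin 10) Zhalf := X 6
def wA2 : MvPolynomial (Fin 10) Zhalf := X 7
def wB2 : MvPolynomial (Fin 10) Zhalf := X 8
def wC2 : MvPolynomial (Fin 10) Zhalf := X 9

/-- The coefficient-substitution homomorphism `σ` encoding the `PGL₂`-action. -/
def σPGL : MvPolynomial (Fin 6) Zhalf →ₐ[Zhalf] MvPolynomial (Fin 10) Zhalf :=
  aeval ![wA1 * va ^ 2 + wB1 * va * vc + wC1 * vc ^ 2,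
          2 * wA1 * va * vb + wB1 * (va * vd + vb * vc) + 2 * wC1 * vc * vd,
          wA1 * vb ^ 2 + wB1 * vb * vd + wC1 * vd ^ 2,
          wA2 * va ^ 2 + wB2 * va * vc + wC2 * vc ^ 2,
          2 * wA2 * va * vb + wB2 * (va * vd + vb * vc) + 2 * wC2 * vc * vd,
          wA2 * vb ^ 2 + wB2 * vb * vd + wC2 * vd ^ 2]

/-- `p` is a `PGL₂`-invariant: each homogeneous component of degree `n` satisfies
`σ(p) = (ad - bc)ⁿ · p`. -/
def IsPGLInvariant (p : MvPolynomial (Fin 6) Zhalf) : Prop :=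
  ∀ n : ℕ, σPGL (homogeneousComponent n p) =
    (va * vd - vb * vc) ^ n * emb (homogeneousComponent n p)

def Δ₁ : MvPolynomial (Fin 6) Zhalf := X 1 ^ 2 - 4 * X 0 * X 2
def Δ₂ : MvPolynomial (Fin 6) Zhalf := X 4 ^ 2 - 4 * X 3 * X 5
def Γinv : MvPolynomial (Fin 6) Zhalf := X 1 * X 4 - 2 * X 0 * X 5 - 2 * X 2 * X 3

theorem phi_exists : ∃ φ : Zhalf →+* ℂ, Function.Injective φ := by
  have hu : IsUnit ((Int.castRingHom ℂ) (2 : ℤ)) := by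
    rw [isUnit_iff_ne_zero]; norm_num
  refine ⟨IsLocalization.Away.lift (S := Zhalf) (2 : ℤ) hu, ?_⟩
  unfold IsLocalization.Away.lift
  rw [IsLocalization.lift_injective_iff]
  intro x y
  have hinj : Function.Injective (algebraMap ℤ Zhalf) := by
    apply IsLocalization.injective (M := Submonoid.powers (2 : ℤ))
    apply powers_le_nonZeroDivisors_of_noZeroDivisors
    norm_num
  rw [hinj.eq_iff]
  simp

def φC : Zhalf →+* ℂ := phi_exists.choose

theorem φC_inj : Function.Injective φC := phi_exists.choose_spec

def ev {τ : Type} (x : τ → ℂ) : MvPolynomial τ Zhalf →+* ℂ := eval₂Hom φC x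

@[simp] theorem ev_X {τ : Type} (x : τ → ℂ) (i : τ) : ev x (X i) = x i := by simp [ev]
@[simp] theorem ev_C {τ : Type} (x : τ → ℂ) (r : Zhalf) : ev x (C r) = φC r := by simp [ev]

theorem ev_zero {τ : Type} (p : MvPolynomial τ Zhalf) (h : ∀ x, ev x p = 0) : p = 0 := by
  apply MvPolynomial.map_injective φC φC_inj
  rw [map_zero]
  apply MvPolynomial.funext
  intro x
  rw [eval_map, map_zero]
  exact h x

/-- evaluation of a composite -/
theorem ev_aeval {τ υ : Type} (x : υ → ℂ) (f : τ → MvPolynomial υ Zhalf)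
    (p : MvPolynomial τ Zhalf) : ev x (aeval f p) = ev (fun i => ev x (f i)) p := by
  induction p using MvPolynomial.induction_on with
  | C a => simp [algebraMap_eq]
  | add p q hp hq => rw [map_add, map_add, map_add, hp, hq]
  | mul_X p i hp => rw [map_mul, map_mul, map_mul, hp, aeval_X, ev_X]

theorem ev_two {τ : Type} (x : τ → ℂ) : ev x 2 = 2 := map_ofNat _ 2
theorem ev_four {τ : Type} (x : τ → ℂ) : ev x 4 = 4 := map_ofNat _ 4

theorem ev_gens (x : Fin 6 → ℂ) (E : MvPolynomial (Fin 3) Zhalf) :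
    ev x (aeval ![Δ₁, Δ₂, Γinv] E) =
      ev ![x 1 ^ 2 - 4 * x 0 * x 2, x 4 ^ 2 - 4 * x 3 * x 5,
        x 1 * x 4 - 2 * x 0 * x 5 - 2 * x 2 * x 3] E := by
  rw [ev_aeval]
  congr 2
  funext i
  fin_cases i <;> simp [Δ₁, Δ₂, Γinv, ev_two, ev_four]

theorem half_exists : ∃ h : Zhalf, 2 * h = 1 := by
  have := IsLocalization.Away.algebraMap_isUnit (S := Zhalf) (2 : ℤ)
  obtain ⟨u, hu⟩ := this
  refine ⟨↑u⁻¹, ?_⟩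
  have h2 : (2 : Zhalf) = u := by rw [hu]; simp
  rw [h2, Units.mul_inv]

theorem even_odd (p : MvPolynomial (Fin 6) Zhalf) :
    ∃ E O : MvPolynomial (Fin 3) Zhalf, ∀ D r G : ℂ,
      ev ![1, 0, -D / 4, 0, r, -G / 2] p = ev ![D, r ^ 2, G] E + r * ev ![D, r ^ 2, G] O := by
  induction p using MvPolynomial.induction_on with
  | C a => exact ⟨C a, 0, by simp⟩
  | add p q hp hq =>
    obtain ⟨E, O, h⟩ := hp
    obtain ⟨E', O', h'⟩ := hq
    refine ⟨E + E', O + O', fun D r G => ?_⟩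
    simp only [map_add, h, h']; ring
  | mul_X p i hp =>
    obtain ⟨E, O, h⟩ := hp
    obtain ⟨k, hk⟩ := half_exists
    have hk' : φC k = 1 / 2 := by
      have := congrArg φC hk
      simp only [map_mul, map_one, map_ofNat] at this
      linear_combination this / 2
    fin_cases i
    · exact ⟨E, O, fun D r G => by simp [h]⟩
    · exact ⟨0, 0, fun D r G => by simp⟩
    · refine ⟨-(C k * C k * X 0 * E), -(C k * C k * X 0 * O), fun D r G => ?_⟩
      simp [h, hk']; ring
    · exact ⟨0, 0, fun D r G => by simp⟩
    · refine ⟨X 1 * O, E, fun D r G => ?_⟩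
      simp [h]; ring
    · refine ⟨-(C k * X 2 * E), -(C k * X 2 * O), fun D r G => ?_⟩
      simp [h, hk']; ring

theorem ev_inv (p : MvPolynomial (Fin 6) Zhalf) (n : ℕ)
    (hp : σPGL p = (va * vd - vb * vc) ^ n * emb p) (a b c d : ℂ) (h : a * d - b * c = 1)
    (x : Fin 6 → ℂ) :
    ev ![x 0 * a ^ 2 + x 1 * a * c + x 2 * c ^ 2,
          2 * x 0 * a * b + x 1 * (a * d + b * c) + 2 * x 2 * c * d,
          x 0 * b ^ 2 + x 1 * b * d + x 2 * d ^ 2,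
          x 3 * a ^ 2 + x 4 * a * c + x 5 * c ^ 2,
          2 * x 3 * a * b + x 4 * (a * d + b * c) + 2 * x 5 * c * d,
          x 3 * b ^ 2 + x 4 * b * d + x 5 * d ^ 2] p = ev x p := by
  have H := congrArg (ev ![a, b, c, d, x 0, x 1, x 2, x 3, x 4, x 5]) hp
  have h1 : ev ![a, b, c, d, x 0, x 1, x 2, x 3, x 4, x 5] (va * vd - vb * vc) = 1 := by
    simp [va, vb, vc, vd, h]
  rw [map_mul, map_pow, h1, one_pow, one_mul, emb, σPGL, ev_aeval, ev_aeval] at H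
  convert H using 2
  · congr 1
    funext i
    fin_cases i <;> simp [va, vb, vc, vd, wA1, wB1, wC1, wA2, wB2, wC2, ev_two]
  · congr 1
    funext i
    fin_cases i <;> simp

theorem to_normal (p : MvPolynomial (Fin 6) Zhalf) (n : ℕ)
    (hp : σPGL p = (va * vd - vb * vc) ^ n * emb p)
    (x : Fin 6 → ℂ) (r : ℂ) (hr : r ^ 2 = x 4 ^ 2 - 4 * x 3 * x 5) (h3 : x 3 ≠ 0)
    (hres : (x 1 * x 4 - 2 * x 0 * x 5 - 2 * x 2 * x 3) ^ 2 -
      (x 1 ^ 2 - 4 * x 0 * x 2) * (x 4 ^ 2 - 4 * x 3 * x 5) ≠ 0) :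
    ev x p = ev ![1, 0, -(x 1 ^ 2 - 4 * x 0 * x 2) / 4, 0, -r,
      -(x 1 * x 4 - 2 * x 0 * x 5 - 2 * x 2 * x 3) / 2] p := by
  generalize hA1 : x 0 = A1 at *
  generalize hB1 : x 1 = B1 at *
  generalize hC1 : x 2 = C1 at *
  generalize hA2 : x 3 = A2 at *
  generalize hB2 : x 4 = B2 at *
  generalize hC2 : x 5 = C2 at *
  set q : ℂ := A1 * (r - B2) ^ 2 + B1 * (r - B2) * (2 * A2) + C1 * (2 * A2) ^ 2 with hq
  have hq0 : q ≠ 0 := by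
    intro h0
    apply hres
    have : q * (A1 * (-r - B2) ^ 2 + B1 * (-r - B2) * (2 * A2) + C1 * (2 * A2) ^ 2) =
      4 * A2 ^ 2 * ((B1 * B2 - 2 * A1 * C2 - 2 * C1 * A2) ^ 2 -
      (B1 ^ 2 - 4 * A1 * C1) * (B2 ^ 2 - 4 * A2 * C2)) := by
      rw [hq]
      grind
    rw [h0, zero_mul] at this
    have h4 : 4 * A2 ^ 2 ≠ 0 := mul_ne_zero (by norm_num) (pow_ne_zero _ h3)
    exact (mul_eq_zero.mp this.symm).resolve_left h4
  obtain ⟨l, hl⟩ := IsAlgClosed.exists_pow_nat_eq q (n := 2) (by norm_num)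
  have hl0 : l ≠ 0 := by
    rintro rfl
    apply hq0
    rw [← hl]; norm_num
  obtain ⟨a, ha⟩ : ∃ a, a = (r - B2) / l := ⟨_, rfl⟩
  obtain ⟨c, hc⟩ : ∃ c, c = (2 * A2) / l := ⟨_, rfl⟩
  have e1 : A1 * a ^ 2 + B1 * a * c + C1 * c ^ 2 = 1 := by
    rw [ha, hc]; field_simp; rw [hl, hq]; ring
  have e2 : A2 * a ^ 2 + B2 * a * c + C2 * c ^ 2 = 0 := by
    rw [ha, hc]; field_simp; linear_combination A2 * hr
  have e3 : 2 * A2 * a + B2 * c = r * c := by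
    rw [ha, hc]; field_simp; ring
  have e4 : B2 * a + 2 * C2 * c = - r * a := by
    rw [ha, hc]; field_simp; linear_combination hr
  clear_value q
  obtain ⟨b, hb⟩ : ∃ b, b = -(B1 * a + 2 * C1 * c) / 2 := ⟨_, rfl⟩
  obtain ⟨d, hd⟩ : ∃ d, d = (2 * A1 * a + B1 * c) / 2 := ⟨_, rfl⟩
  have hdet : a * d - b * c = 1 := by
    rw [hb, hd]; linear_combination e1
  have f1 : 2 * A1 * a * b + B1 * (a * d + b * c) + 2 * C1 * c * d = 0 := by
    rw [hb, hd]; ring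
  have f2 : A1 * b ^ 2 + B1 * b * d + C1 * d ^ 2 = -(B1 ^ 2 - 4 * A1 * C1) / 4 := by
    rw [hb, hd]; linear_combination (-(B1 ^ 2 - 4 * A1 * C1) / 4) * e1
  have f3 : 2 * A2 * a * b + B2 * (a * d + b * c) + 2 * C2 * c * d = -r := by
    linear_combination b * e3 + d * e4 - r * hdet
  have f4 : A2 * b ^ 2 + B2 * b * d + C2 * d ^ 2 =
      -(B1 * B2 - 2 * A1 * C2 - 2 * C1 * A2) / 2 := by
    have hG : (2 * A1 * a * b + B1 * (a * d + b * c) + 2 * C1 * c * d) *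
        (2 * A2 * a * b + B2 * (a * d + b * c) + 2 * C2 * c * d)
        - 2 * (A1 * a ^ 2 + B1 * a * c + C1 * c ^ 2) * (A2 * b ^ 2 + B2 * b * d + C2 * d ^ 2)
        - 2 * (A1 * b ^ 2 + B1 * b * d + C1 * d ^ 2) * (A2 * a ^ 2 + B2 * a * c + C2 * c ^ 2)
        = (B1 * B2 - 2 * A1 * C2 - 2 * C1 * A2) * (a * d - b * c) ^ 2 := by ring
    rw [e1, e2, f1, hdet] at hG
    linear_combination (-1 / 2) * hG
  have H := ev_inv p n hp a b c d hdet x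
  rw [hA1, hB1, hC1, hA2, hB2, hC2, e1, e2, f1, f2, f3, f4] at H
  exact H.symm

theorem hom_mem (p : MvPolynomial (Fin 6) Zhalf) (n : ℕ)
    (hp : σPGL p = (va * vd - vb * vc) ^ n * emb p) :
    ∃ E : MvPolynomial (Fin 3) Zhalf, p = aeval ![Δ₁, Δ₂, Γinv] E := by
  obtain ⟨E, O, h⟩ := even_odd p
  refine ⟨E, ?_⟩
  have key : (p - aeval ![Δ₁, Δ₂, Γinv] E) * (X 3 * (Γinv ^ 2 - Δ₁ * Δ₂)) = 0 := by
    apply ev_zero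
    intro x
    rw [map_mul, mul_eq_zero, or_iff_not_imp_right]
    intro hne
    rw [map_mul, ← ne_eq, mul_ne_zero_iff] at hne
    obtain ⟨h3, hres⟩ := hne
    rw [ev_X] at h3
    have hres' : (x 1 * x 4 - 2 * x 0 * x 5 - 2 * x 2 * x 3) ^ 2 -
      (x 1 ^ 2 - 4 * x 0 * x 2) * (x 4 ^ 2 - 4 * x 3 * x 5) ≠ 0 := by
      simpa [Δ₁, Δ₂, Γinv, ev_two, ev_four] using hres
    obtain ⟨r, hr⟩ := IsAlgClosed.exists_pow_nat_eq (x 4 ^ 2 - 4 * x 3 * x 5) (n := 2)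
      (by norm_num)
    have k1 := to_normal p n hp x r hr h3 hres'
    have k2 := to_normal p n hp x (-r) (by rw [neg_sq, hr]) h3 hres'
    rw [h] at k1 k2
    rw [neg_neg] at k2
    rw [neg_sq] at k1
    rw [map_sub, ev_gens, ← hr]
    linear_combination (k1 + k2) / 2
  have hne : (X 3 * (Γinv ^ 2 - Δ₁ * Δ₂) : MvPolynomial (Fin 6) Zhalf) ≠ 0 := by
    intro h0
    have := congrArg (ev ![1, 0, 0, 1, 0, 1]) h0
    simp [Δ₁, Δ₂, Γinv, ev_two, ev_four] at this
  have hdom : IsDomain Zhalf := φC_inj.isDomain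
  exact sub_eq_zero.mp ((mul_eq_zero.mp key).resolve_right hne)

theorem two_eq_C {τ : Type} : (2 : MvPolynomial τ Zhalf) = C 2 := (map_ofNat C 2).symm
theorem four_eq_C {τ : Type} : (4 : MvPolynomial τ Zhalf) = C 4 := (map_ofNat C 4).symm

theorem hX (i j : Fin 6) : (X i * X j : MvPolynomial (Fin 6) Zhalf).IsHomogeneous 2 :=
  (isHomogeneous_X _ i).mul (isHomogeneous_X _ j)

theorem hD1 : Δ₁.IsHomogeneous 2 := by
  rw [Δ₁, pow_two, four_eq_C, mul_assoc]
  exact (hX _ _).sub ((hX _ _).C_mul _)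
theorem hD2 : Δ₂.IsHomogeneous 2 := by
  rw [Δ₂, pow_two, four_eq_C, mul_assoc]
  exact (hX _ _).sub ((hX _ _).C_mul _)
theorem hGam : Γinv.IsHomogeneous 2 := by
  rw [Γinv, two_eq_C, mul_assoc, mul_assoc]
  exact ((hX _ _).sub ((hX _ _).C_mul _)).sub ((hX _ _).C_mul _)

theorem sD1 : σPGL Δ₁ = (va * vd - vb * vc) ^ 2 * emb Δ₁ := by
  simp only [σPGL, emb, Δ₁, map_sub, map_mul, map_pow, aeval_X, map_ofNat]
  change _ = (va * vd - vb * vc) ^ 2 * (wB1 ^ 2 - 4 * wA1 * wC1)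
  simp; ring
theorem sD2 : σPGL Δ₂ = (va * vd - vb * vc) ^ 2 * emb Δ₂ := by
  simp only [σPGL, emb, Δ₂, map_sub, map_mul, map_pow, aeval_X, map_ofNat]
  change _ = (va * vd - vb * vc) ^ 2 * (wB2 ^ 2 - 4 * wA2 * wC2)
  simp; ring
theorem sGam : σPGL Γinv = (va * vd - vb * vc) ^ 2 * emb Γinv := by
  simp only [σPGL, emb, Γinv, map_sub, map_mul, map_pow, aeval_X, map_ofNat]
  change _ = (va * vd - vb * vc) ^ 2 * (wB1 * wB2 - 2 * wA1 * wC2 - 2 * wC1 * wA2)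
  simp; ring

theorem inv_of_hom (p : MvPolynomial (Fin 6) Zhalf) (n : ℕ) (h : p.IsHomogeneous n)
    (hs : σPGL p = (va * vd - vb * vc) ^ n * emb p) : IsPGLInvariant p := by
  intro m
  rw [homogeneousComponent_of_mem ((mem_homogeneousSubmodule n p).mpr h)]
  split_ifs with hm
  · rw [hm, hs]
  · simp

theorem inv_gens (E : MvPolynomial (Fin 3) Zhalf) :
    IsPGLInvariant (aeval ![Δ₁, Δ₂, Γinv] E) := by
  induction E using MvPolynomial.induction_on' with
  | add p q hp hq =>
    intro n
    rw [map_add, map_add, map_add, map_add, hp n, hq n, mul_add]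
  | monomial u a =>
    have : ∃ n, (aeval ![Δ₁, Δ₂, Γinv] (monomial u a)).IsHomogeneous n ∧
        σPGL (aeval ![Δ₁, Δ₂, Γinv] (monomial u a)) =
        (va * vd - vb * vc) ^ n * emb (aeval ![Δ₁, Δ₂, Γinv] (monomial u a)) := by
      refine MvPolynomial.induction_on_monomial (motive := fun f => ∃ n,
        (aeval ![Δ₁, Δ₂, Γinv] f).IsHomogeneous n ∧ σPGL (aeval ![Δ₁, Δ₂, Γinv] f) =
        (va * vd - vb * vc) ^ n * emb (aeval ![Δ₁, Δ₂, Γinv] f)) ?_ ?_ u a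
      · intro a
        refine ⟨0, ?_, ?_⟩
        · rw [aeval_C]; exact isHomogeneous_C _ _
        · simp
      · intro p i hp
        obtain ⟨n, h1, h2⟩ := hp
        refine ⟨n + 2, ?_, ?_⟩
        · rw [map_mul, aeval_X]
          apply h1.mul
          fin_cases i
          · exact hD1
          · exact hD2
          · exact hGam
        · have h3 : σPGL (![Δ₁, Δ₂, Γinv] i) = (va * vd - vb * vc) ^ 2 * emb (![Δ₁, Δ₂, Γinv] i) := by
            fin_cases i
            · exact sD1
            · exact sD2
            · exact sGam
          rw [map_mul, aeval_X, map_mul, map_mul, h2, h3]; ring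
    obtain ⟨n, h1, h2⟩ := this
    exact inv_of_hom _ n h1 h2

/-- Over `ℤ[1/2]`, the ring of `PGL₂`-invariants is the subalgebra generated by
`Δ₁, Δ₂, Γ`, and these are algebraically independent, so the invariant ring is the
polynomial ring `ℤ[1/2][Δ₁,Δ₂,Γ]`. -/
theorem pgl2_invariants_over_Z_half :
    (∀ p : MvPolynomial (Fin 6) Zhalf,
      IsPGLInvariant p ↔
        p ∈ Algebra.adjoin Zhalf ({Δ₁, Δ₂, Γinv} : Set (MvPolynomial (Fin 6) Zhalf))) ∧
    AlgebraicIndependent Zhalf ![Δ₁, Δ₂, Γinv] := by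
  have hset : ({Δ₁, Δ₂, Γinv} : Set (MvPolynomial (Fin 6) Zhalf)) =
      Set.range ![Δ₁, Δ₂, Γinv] := by
    ext q
    simp
    tauto
  refine ⟨fun p => ?_, ?_⟩
  · rw [hset, Algebra.adjoin_range_eq_range_aeval]
    constructor
    · intro h
      rw [← sum_homogeneousComponent p]
      refine Subalgebra.sum_mem _ fun n _ => ?_
      obtain ⟨E, hE⟩ := hom_mem _ n (h n)
      exact ⟨E, hE.symm⟩
    · rintro ⟨E, rfl⟩
      exact inv_gens E
  · rw [algebraicIndependent_iff]
    intro E hE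
    apply ev_zero
    intro y
    obtain ⟨r, hr⟩ := IsAlgClosed.exists_pow_nat_eq (y 1) (n := 2) (by norm_num)
    have H := ev_gens ![1, 0, -(y 0) / 4, 0, r, -(y 2) / 2] E
    rw [hE, map_zero] at H
    rw [H]
    congr 2
    funext i
    fin_cases i
    · simp; ring
    · simp [hr]
    · simp; ring
end
end

section
/- The fixed subalgebra of the polynomial ring 𝔽₂[x,y,u] under the 𝔽₂-algebra automorphism fixing x and y and sending u ↦ u + xy is exactly the 𝔽₂-subalgebra generated by x, y, and u² + xyu. -/
open MvPolynomial

noncomputable section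

/- Variables in `MvPolynomial (Fin 3) (ZMod 2)`: `0 = x, 1 = y, 2 = u`. -/

/-- The `𝔽₂`-algebra endomorphism `τ` of `𝔽₂[x,y,u]` with `x ↦ x`, `y ↦ y`, `u ↦ u + xy`
(an involution in characteristic 2). -/
def τ : MvPolynomial (Fin 3) (ZMod 2) →ₐ[ZMod 2] MvPolynomial (Fin 3) (ZMod 2) :=
  aeval ![X 0, X 1, X 2 + X 0 * X 1]

abbrev SS : Subalgebra (ZMod 2) (MvPolynomial (Fin 3) (ZMod 2)) :=
  Algebra.adjoin (ZMod 2)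
        ({X 0, X 1, X 2 ^ 2 + X 0 * X 1 * X 2} : Set (MvPolynomial (Fin 3) (ZMod 2)))

lemma two_zero : (2 : MvPolynomial (Fin 3) (ZMod 2)) = 0 := CharTwo.two_eq_zero

lemma SS_fixed (p : MvPolynomial (Fin 3) (ZMod 2)) (hp : p ∈ SS) : τ p = p := by
  have h : SS ≤ AlgHom.equalizer τ (AlgHom.id _ _) := by
    refine Algebra.adjoin_le ?_
    rintro q (rfl | rfl | rfl)
    · simp [τ, AlgHom.mem_equalizer]
    · simp [τ, AlgHom.mem_equalizer]
    · simp only [τ, SetLike.mem_coe, AlgHom.mem_equalizer, map_add, map_mul, map_pow, aeval_X,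
        AlgHom.id_apply]
      simp only [Matrix.cons_val]
      linear_combination (X 0 * X 1 * X 2 + X 0 ^ 2 * X 1 ^ 2) * two_zero
  simpa [AlgHom.mem_equalizer] using h hp

lemma decomp (p : MvPolynomial (Fin 3) (ZMod 2)) : ∃ a ∈ SS, ∃ b ∈ SS, p = a + b * X 2 := by
  have h0 : (X 0 : MvPolynomial (Fin 3) (ZMod 2)) ∈ SS := Algebra.subset_adjoin (by simp)
  have h1 : (X 1 : MvPolynomial (Fin 3) (ZMod 2)) ∈ SS := Algebra.subset_adjoin (by simp)
  have h2 : (X 2 ^ 2 + X 0 * X 1 * X 2 : MvPolynomial (Fin 3) (ZMod 2)) ∈ SS :=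
    Algebra.subset_adjoin (by simp)
  induction p using MvPolynomial.induction_on with
  | C r => exact ⟨C r, SS.algebraMap_mem r, 0, zero_mem _, by simp⟩
  | add p q hp hq =>
    obtain ⟨a, ha, b, hb, rfl⟩ := hp
    obtain ⟨c, hc, d, hd, rfl⟩ := hq
    exact ⟨a + c, add_mem ha hc, b + d, add_mem hb hd, by ring⟩
  | mul_X p i hp =>
    obtain ⟨a, ha, b, hb, rfl⟩ := hp
    fin_cases i
    · exact ⟨a * X 0, mul_mem ha h0, b * X 0, mul_mem hb h0, by simp; ring⟩
    · exact ⟨a * X 1, mul_mem ha h1, b * X 1, mul_mem hb h1, by simp; ring⟩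
    · refine ⟨_, mul_mem hb h2, a - b * (X 0 * X 1),
        sub_mem ha (mul_mem hb (mul_mem h0 h1)), ?_⟩
      simp only [Fin.reduceFinMk]
      ring

/-- The fixed subalgebra of `𝔽₂[x,y,u]` under `x ↦ x`, `y ↦ y`, `u ↦ u + xy` is exactly
the `𝔽₂`-subalgebra generated by `x`, `y` and `u² + xyu`. -/
theorem fixed_points_char_two (p : MvPolynomial (Fin 3) (ZMod 2)) :
    τ p = p ↔
      p ∈ Algebra.adjoin (ZMod 2)
        ({X 0, X 1, X 2 ^ 2 + X 0 * X 1 * X 2} : Set (MvPolynomial (Fin 3) (ZMod 2))) := by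
  refine ⟨fun h => ?_, SS_fixed p⟩
  obtain ⟨a, ha, b, hb, rfl⟩ := decomp p
  have hu : τ (X 2) = X 2 + X 0 * X 1 := by simp [τ]
  rw [map_add, map_mul, SS_fixed a ha, SS_fixed b hb, hu] at h
  have h' : b * (X 0 * X 1) = 0 := by linear_combination h
  have hb0 : b = 0 := by
    rcases mul_eq_zero.1 h' with h | h
    · exact h
    · exact absurd h (mul_ne_zero (X_ne_zero _) (X_ne_zero _))
  subst hb0
  simpa using ha
end
end
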